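/- arXiv:1303.3883 — 3 statements merged into one kernel-verified Lean document; each statement's English description precedes it below -/
import Mathlib

section
/- Let G be a group and V an additive commutative group, equipped with a left action of G on V by additive maps (written g·v, satisfying e·v = v, (gh)·v = g·(h·v), g·(v+w) = g·v + g·w) and a right action of G on V by additive maps (written v·g, satisfying v·e = v, (v·g)·h = v·(gh), (v+w)·g = v·g + w·g). If the two actions commute, i.e. (g·v)·h = g·(v·h) for all g,h ∈ G and v ∈ V, then the set G × V equipped with the composition (g₁,v₁)·(g₂,v₂) = (g₁g₂, g₁·v₂ + v₁·g₂) is a group, with identity element (e, 0). -/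
/-- The centered semi-direct product `G ⋈ V`: given commuting left and right
actions of a group `G` on an additive commutative group `V` by additive maps,
the composition `(g₁,v₁)·(g₂,v₂) = (g₁g₂, g₁·v₂ + v₁·g₂)` on `G × V` is
associative, has identity `(1, 0)`, and every element has a two-sided inverse;
i.e. it makes `G × V` into a group. -/
theorem centered_semidirect_product_is_group
    {G V : Type*} [Group G] [AddCommGroup V]
    (l : G → V → V) (r : V → G → V)
    (hl_one : ∀ v : V, l 1 v = v)
    (hl_mul : ∀ (g h : G) (v : V), l (g * h) v = l g (l h v))
    (hl_add : ∀ (g : G) (v w : V), l g (v + w) = l g v + l g w)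
    (hr_one : ∀ v : V, r v 1 = v)
    (hr_mul : ∀ (g h : G) (v : V), r (r v g) h = r v (g * h))
    (hr_add : ∀ (g : G) (v w : V), r (v + w) g = r v g + r w g)
    (hcomm : ∀ (g h : G) (v : V), r (l g v) h = l g (r v h)) :
    let mul : G × V → G × V → G × V :=
      fun p q => (p.1 * q.1, l p.1 q.2 + r p.2 q.1)
    (∀ p q s : G × V, mul (mul p q) s = mul p (mul q s)) ∧
    (∀ p : G × V, mul ((1 : G), (0 : V)) p = p) ∧
    (∀ p : G × V, mul p ((1 : G), (0 : V)) = p) ∧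
    (∀ p : G × V, ∃ q : G × V,
      mul p q = ((1 : G), (0 : V)) ∧ mul q p = ((1 : G), (0 : V))) := by
  intro mul
  have hl0 : ∀ g, l g 0 = 0 := fun g => by
    have h := hl_add g 0 0
    rw [add_zero] at h
    exact left_eq_add.mp h
  have hr0 : ∀ g, r 0 g = 0 := fun g => by
    have h := hr_add g 0 0
    rw [add_zero] at h
    exact left_eq_add.mp h
  have hln : ∀ g v, l g (-v) = -l g v := fun g v => by
    rw [eq_neg_iff_add_eq_zero, ← hl_add, neg_add_cancel, hl0]
  have hrn : ∀ g v, r (-v) g = -r v g := fun g v => by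
    rw [eq_neg_iff_add_eq_zero, ← hr_add, neg_add_cancel, hr0]
  refine ⟨?_, ?_, ?_, ?_⟩
  · rintro ⟨a, u⟩ ⟨b, v⟩ ⟨c, w⟩
    simp only [mul, mul_assoc, hl_mul, hl_add, hr_add, hr_mul, hcomm, add_assoc]
  · rintro ⟨a, u⟩
    simp only [mul, one_mul, hl_one, hr0, add_zero]
  · rintro ⟨a, u⟩
    simp only [mul, mul_one, hr_one, hl0, zero_add]
  · rintro ⟨g, v⟩
    refine ⟨(g⁻¹, -(l g⁻¹ (r v g⁻¹))), ?_, ?_⟩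
    · simp only [mul, hln, ← hl_mul, mul_inv_cancel, hl_one, neg_add_cancel]
    · simp only [mul, hrn, hcomm, hr_mul, inv_mul_cancel, hr_one, add_neg_cancel]
end

section
/- Fix n ≥ 1 and let P : ℝ × ℝ → Matrix (Fin n) (Fin n) ℝ be a C² map (in the two variables jointly) such that P(t,ε) is invertible for every (t,ε). Define ξ(t,ε) = (∂P/∂t)(t,ε) * P(t,ε)⁻¹ and η(t,ε) = (∂P/∂ε)(t,ε) * P(t,ε)⁻¹, where the partial derivatives are the derivatives of P in each variable separately. Then for all (t,ε): (∂ξ/∂ε)(t,ε) = (∂η/∂t)(t,ε) − (ξ(t,ε)*η(t,ε) − η(t,ε)*ξ(t,ε)). In other words, the variation of the right-trivialized velocity ξ induced by the variation η of the curve satisfies δξ = η̇ − [ξ,η], where [·,·] is the matrix commutator. -/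
theorem vrt_generic_mul_inverse {A : Type*} [NormedRing A] [NormedAlgebra ℝ A] [CompleteSpace A]
    {F G : ℝ → A} {F' G' : A} {x : ℝ} (hF : HasDerivAt F F' x) (hG : HasDerivAt G G' x)
    (hu : IsUnit (G x)) :
    HasDerivAt (fun y => F y * Ring.inverse (G y))
      (F' * Ring.inverse (G x) - F x * (Ring.inverse (G x) * G' * Ring.inverse (G x))) x := by
  obtain ⟨u, hu⟩ := hu
  have h1 := hasFDerivAt_ringInverse (𝕜 := ℝ) u
  rw [hu] at h1
  have h2 := h1.comp_hasDerivAt x hG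
  have h3 := hF.mul h2
  have e : F' * Ring.inverse (G x) - F x * (Ring.inverse (G x) * G' * Ring.inverse (G x)) =
      F' * Ring.inverse (G x) +
        F x * ((-ContinuousLinearMap.mulLeftRight ℝ A ↑u⁻¹ ↑u⁻¹) G') := by
    simp [← hu, sub_eq_add_neg]
  rw [e]
  exact h3

theorem vrt_partials {E : Type*} [NormedAddCommGroup E] [NormedSpace ℝ E] (P : ℝ × ℝ → E)
    (hP : ContDiff ℝ 2 P) :
    ∃ Pt Pe M : ℝ → ℝ → E,
      (∀ t e, HasDerivAt (fun s => P (s, e)) (Pt t e) t) ∧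
      (∀ t e, HasDerivAt (fun s => P (t, s)) (Pe t e) e) ∧
      (∀ t e, HasDerivAt (fun s => Pt t s) (M t e) e) ∧
      (∀ t e, HasDerivAt (fun s => Pe s e) (M t e) t) := by
  have hd : ∀ p, HasFDerivAt P (fderiv ℝ P p) p := fun p =>
    ((hP.differentiable (by norm_num)) p).hasFDerivAt
  have hd2 : ∀ p, HasFDerivAt (fderiv ℝ P) (fderiv ℝ (fderiv ℝ P) p) p := fun p =>
    (((hP.fderiv_right (m := 1) (by norm_num)).differentiable (by norm_num)) p).hasFDerivAt
  have c1 : ∀ t e : ℝ, HasDerivAt (fun s : ℝ => (s, e)) ((1 : ℝ), (0 : ℝ)) t := fun t e =>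
    (hasDerivAt_id t).prodMk (hasDerivAt_const t e)
  have c2 : ∀ t e : ℝ, HasDerivAt (fun s : ℝ => (t, s)) ((0 : ℝ), (1 : ℝ)) e := fun t e =>
    (hasDerivAt_const e t).prodMk (hasDerivAt_id e)
  refine ⟨fun t e => fderiv ℝ P (t, e) (1, 0), fun t e => fderiv ℝ P (t, e) (0, 1),
    fun t e => fderiv ℝ (fderiv ℝ P) (t, e) (0, 1) (1, 0), ?_, ?_, ?_, ?_⟩
  · intro t e
    exact (hd (t, e)).comp_hasDerivAt t (c1 t e)
  · intro t e
    exact (hd (t, e)).comp_hasDerivAt e (c2 t e)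
  · intro t e
    have h := (hd2 (t, e)).comp_hasDerivAt e (c2 t e)
    have h' := h.clm_apply (hasDerivAt_const e ((1 : ℝ), (0 : ℝ)))
    simpa using h'
  · intro t e
    have h := (hd2 (t, e)).comp_hasDerivAt t (c1 t e)
    have h' := h.clm_apply (hasDerivAt_const t ((0 : ℝ), (1 : ℝ)))
    have hs : IsSymmSndFDerivAt ℝ P (t, e) :=
      hP.contDiffAt.isSymmSndFDerivAt (by simp)
    simp only []
    rw [hs (0, 1) (1, 0)]
    simpa using h'

section
attribute [local instance] Matrix.linftyOpNormedRing Matrix.linftyOpNormedAlgebra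

theorem vrt_matrix_mul_inv {n : ℕ}
    {F G : ℝ → Matrix (Fin n) (Fin n) ℝ} {F' G' : Matrix (Fin n) (Fin n) ℝ} {x : ℝ}
    (hF : HasDerivAt F F' x) (hG : HasDerivAt G G' x)
    (hu : IsUnit (G x).det) :
    HasDerivAt (fun y => F y * (G y)⁻¹)
      (F' * (G x)⁻¹ - F x * ((G x)⁻¹ * G' * (G x)⁻¹)) x := by
  simp only [Matrix.nonsing_inv_eq_ringInverse]
  have : CompleteSpace (Matrix (Fin n) (Fin n) ℝ) := FiniteDimensional.complete ℝ _
  exact vrt_generic_mul_inverse hF hG ((Matrix.isUnit_iff_isUnit_det _).2 hu)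

end

attribute [local instance] Matrix.normedAddCommGroup Matrix.normedSpace

/-- Variation formula for the right-trivialized velocity: if `P(t,ε)` is a `C²`
family of invertible matrices, `ξ = (∂P/∂t) P⁻¹` and `η = (∂P/∂ε) P⁻¹`, then
`∂ξ/∂ε = ∂η/∂t − (ξη − ηξ)`, i.e. `δξ = η̇ − [ξ, η]`. -/
theorem variation_of_right_trivialized_velocity
    {n : ℕ} (hn : 1 ≤ n)
    (P : ℝ × ℝ → Matrix (Fin n) (Fin n) ℝ)
    (hP : ContDiff ℝ 2 P)
    (hPinv : ∀ te : ℝ × ℝ, IsUnit (P te).det)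
    (ξ η : ℝ → ℝ → Matrix (Fin n) (Fin n) ℝ)
    (hξ : ∀ t ε : ℝ, ξ t ε = deriv (fun s => P (s, ε)) t * (P (t, ε))⁻¹)
    (hη : ∀ t ε : ℝ, η t ε = deriv (fun e => P (t, e)) ε * (P (t, ε))⁻¹) :
    ∀ t ε : ℝ,
      deriv (fun e => ξ t e) ε =
        deriv (fun s => η s ε) t - (ξ t ε * η t ε - η t ε * ξ t ε) := by
  intro t ε
  obtain ⟨Pt, Pe, M, h1, h2, h3, h4⟩ := vrt_partials P hP
  have eξ : ∀ t ε, ξ t ε = Pt t ε * (P (t, ε))⁻¹ := fun t ε => by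
    have h : deriv (fun s => P (s, ε)) t = Pt t ε := (h1 t ε).deriv
    rw [hξ, h]
  have eη : ∀ t ε, η t ε = Pe t ε * (P (t, ε))⁻¹ := fun t ε => by
    have h : deriv (fun s => P (t, s)) ε = Pe t ε := (h2 t ε).deriv
    rw [hη, h]
  have d1 : deriv (fun e => ξ t e) ε = M t ε * (P (t, ε))⁻¹ -
      Pt t ε * ((P (t, ε))⁻¹ * Pe t ε * (P (t, ε))⁻¹) := by
    simp only [eξ]
    exact (vrt_matrix_mul_inv (h3 t ε) (h2 t ε) (hPinv (t, ε))).deriv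
  have d2 : deriv (fun s => η s ε) t = M t ε * (P (t, ε))⁻¹ -
      Pe t ε * ((P (t, ε))⁻¹ * Pt t ε * (P (t, ε))⁻¹) := by
    simp only [eη]
    exact (vrt_matrix_mul_inv (h4 t ε) (h1 t ε) (hPinv (t, ε))).deriv
  rw [d1, d2, eξ, eη]
  noncomm_ring
end

section
/- Fix n ≥ 1. Let T, α : Fin n → Fin n → Fin n → ℝ be a (1,2)-tensor (indexed T^i_{jk}) and a (2,1)-tensor (indexed α_i^{jk}) respectively. Define, for a matrix ξ : Fin n → Fin n → ℝ, the infinitesimal left action (ξ·T)^i_{jk} = Σ_l ξ^i_l T^l_{jk} and the infinitesimal right action (T·ξ)^i_{jk} = Σ_l (T^i_{lk} ξ^l_j + T^i_{jl} ξ^l_k), the tensor pairing ⟨α, T⟩ = Σ_{i,j,k} α_i^{jk} T^i_{jk}, and the matrix pairing ⟨μ, ξ⟩ = Σ_{i,j} μ_i^j ξ^i_j. Then for all matrices ξ: ⟨α, T·ξ − ξ·T⟩ = ⟨α ◊ T, ξ⟩, where (α ◊ T)_i^j = Σ_{l,k} (α_l^{jk} T^l_{ik} + α_l^{kj} T^l_{ki}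 − α_i^{lk} T^j_{lk}). That is, the diamond operator of the centered semi-direct product 𝔤𝔩(n) ⋈ 𝒯¹₂ is given by this explicit index formula. -/
open Finset

theorem diamond_sum_perm_three {n : ℕ} (F : Fin n → Fin n → Fin n → Fin n → ℝ) :
    ∑ i, ∑ j, ∑ k, ∑ l, F i j k l = ∑ a, ∑ b, ∑ c, ∑ d, F a c d b := by
  refine Finset.sum_congr rfl fun i _ => ?_
  rw [Finset.sum_comm (s := univ) (f := fun b c => ∑ d, F i c d b)]
  exact Finset.sum_congr rfl fun j _ => Finset.sum_comm

theorem diamond_sum_perm_one {n : ℕ} (F : Fin n → Fin n → Fin n → Fin n → ℝ) :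
    ∑ i, ∑ j, ∑ k, ∑ l, F i j k l = ∑ a, ∑ b, ∑ c, ∑ d, F c b d a := by
  rw [diamond_sum_perm_three, Finset.sum_comm]
  exact Finset.sum_congr rfl fun a _ => Finset.sum_comm

theorem diamond_sum_perm_two {n : ℕ} (F : Fin n → Fin n → Fin n → Fin n → ℝ) :
    ∑ i, ∑ j, ∑ k, ∑ l, F i j k l = ∑ a, ∑ b, ∑ c, ∑ d, F c d b a := by
  rw [← diamond_sum_perm_one (fun c b d a => F c d b a)]
  exact Finset.sum_congr rfl fun i _ => Finset.sum_comm

/-- The diamond operator of `𝔤𝔩(n) ⋈ 𝒯¹₂` in index notation: with the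
infinitesimal left action `(ξ·T)^i_{jk} = ξ^i_l T^l_{jk}`, the infinitesimal
right action `(T·ξ)^i_{jk} = T^i_{lk} ξ^l_j + T^i_{jl} ξ^l_k`, the tensor
pairing `⟨α, T⟩ = α_i^{jk} T^i_{jk}` and the matrix pairing
`⟨μ, ξ⟩ = μ_i^j ξ^i_j`, one has `⟨α, T·ξ − ξ·T⟩ = ⟨α ◊ T, ξ⟩` where
`(α ◊ T)_i^j = α_l^{jk} T^l_{ik} + α_l^{kj} T^l_{ki} − α_i^{lk} T^j_{lk}`. -/
theorem diamond_operator_tensors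
    {n : ℕ} (hn : 1 ≤ n)
    (T α : Fin n → Fin n → Fin n → ℝ) :
    ∀ ξ : Fin n → Fin n → ℝ,
      (∑ i, ∑ j, ∑ k, α i j k *
          ((∑ l, (T i l k * ξ l j + T i j l * ξ l k)) - (∑ l, ξ i l * T l j k))) =
      ∑ i, ∑ j,
          (∑ l, ∑ k, (α l j k * T l i k + α l k j * T l k i - α i l k * T j l k)) *
            ξ i j := by
  intro ξ
  have h1 := diamond_sum_perm_one (fun i j k l => α i j k * (T i l k * ξ l j))
  have h2 := diamond_sum_perm_two (fun i j k l => α i j k * (T i j l * ξ l k))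
  have h3 := diamond_sum_perm_three (fun i j k l => α i j k * (ξ i l * T l j k))
  simp only [mul_sub, Finset.mul_sum, mul_add, Finset.sum_add_distrib, Finset.sum_sub_distrib,
    add_mul, sub_mul, Finset.sum_mul]
  rw [h1, h2, h3]
  have e (a b c : ℝ) : a * (b * c) = a * b * c := (mul_assoc a b c).symm
  have e3 (a b c : ℝ) : a * b * c = a * c * b := mul_right_comm a b c
  congr 1
  · simp only [e]
  · simp only [e]
    simp only [e3 _ (ξ _ _)]
end
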